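/- Let Ω ⊂ ℝ² be a bounded simply connected open set whose boundary consists of finitely many disjoint open straight segments A₁,…,A_k and B₁,…,B_l, finitely many disjoint open convex C¹ arcs C₁,…,C_n with n ≥ 1 (Ω locally convex along each Cⱼ), and a finite set of vertices. Let u₁ and u₂ be C² solutions of the minimal surfaces equation in Ω such that, for i = 1,2, uᵢ → +∞ on each A_j, uᵢ → −∞ on each B_j, and uᵢ extends continuously to each C_j with u₁ = u₂ on each C_j. Then u₁ = u₂ in Ω. -/

import Mathlib

open Real Filter Set Topology MeasureTheory

/-- Partial derivative in the first (x) variable. -/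
noncomputable def pd1 (u : ℝ × ℝ → ℝ) (z : ℝ × ℝ) : ℝ := deriv (fun t => u (t, z.2)) z.1

/-- Partial derivative in the second (y) variable. -/
noncomputable def pd2 (u : ℝ × ℝ → ℝ) (z : ℝ × ℝ) : ℝ := deriv (fun t => u (z.1, t)) z.2

/-- `W = √(1 + p² + q²)` for the function `u`. -/
noncomputable def Wg (u : ℝ × ℝ → ℝ) (z : ℝ × ℝ) : ℝ :=
  Real.sqrt (1 + pd1 u z ^ 2 + pd2 u z ^ 2)

/-- `u` is a C² solution of the minimal surfaces equation
`(1+q²)r − 2pq·s + (1+p²)t = 0` on `Ω`. -/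
def IsMSE (u : ℝ × ℝ → ℝ) (Ω : Set (ℝ × ℝ)) : Prop :=
  ContDiffOn ℝ 2 u Ω ∧ ∀ z ∈ Ω,
    (1 + pd2 u z ^ 2) * pd1 (pd1 u) z
      - 2 * pd1 u z * pd2 u z * pd2 (pd1 u) z
      + (1 + pd1 u z ^ 2) * pd2 (pd2 u) z = 0

/-- Euclidean length of a planar vector. -/
noncomputable def len (v : ℝ × ℝ) : ℝ := Real.sqrt (v.1 ^ 2 + v.2 ^ 2)

/-- Euclidean open disk in the plane. -/
def eball (P : ℝ × ℝ) (ρ : ℝ) : Set (ℝ × ℝ) := {z | len (z - P) < ρ}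

/-- `C` is an open regular C¹ arc in the plane. -/
def IsC1Arc (C : Set (ℝ × ℝ)) : Prop :=
  ∃ γ : ℝ → ℝ × ℝ, ContDiff ℝ 1 γ ∧ InjOn γ (Icc 0 1) ∧
    (∀ t ∈ Icc (0:ℝ) 1, deriv γ t ≠ 0) ∧ C = γ '' Ioo 0 1

/-- `Ω` is locally convex along the boundary arc `C`. -/
def LocallyConvexAlong (Ω C : Set (ℝ × ℝ)) : Prop :=
  ∀ z ∈ C, ∃ ε > 0, Convex ℝ (Ω ∩ eball z ε)


lemma E_hasDeriv (x : ℝ) : HasDerivAt expNegInvGlue ((x⁻¹)^2 * expNegInvGlue x) x := by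
  have := expNegInvGlue.hasDerivAt_polynomial_eval_inv_mul 1 x
  simpa using this

lemma E_le_one (x : ℝ) : expNegInvGlue x ≤ 1 := by
  unfold expNegInvGlue
  split_ifs with h
  · norm_num
  · push Not at h
    rw [Real.exp_le_one_iff]
    have := inv_pos.2 h
    linarith

lemma E_deriv_nonneg (x : ℝ) : 0 ≤ (x⁻¹)^2 * expNegInvGlue x :=
  mul_nonneg (sq_nonneg _) (expNegInvGlue.nonneg x)

lemma E_deriv_le (x : ℝ) : (x⁻¹)^2 * expNegInvGlue x ≤ 1 := by
  unfold expNegInvGlue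
  split_ifs with h
  · norm_num
  · push Not at h
    have hy := inv_pos.2 h
    set y := x⁻¹
    rw [Real.exp_neg, ← div_eq_mul_inv, div_le_one (Real.exp_pos _)]
    have h1 : 1 + y/4 ≤ Real.exp (y/4) := by linarith [Real.add_one_le_exp (y/4)]
    have h2 : Real.exp y = ((Real.exp (y/4))^2)^2 := by
      rw [← Real.exp_nat_mul, ← Real.exp_nat_mul]; congr 1; push_cast; ring
    rw [h2]
    have h3 : y ≤ (Real.exp (y/4))^2 := by nlinarith [sq_nonneg (1 - y/4)]
    gcongr

lemma E_deriv_pos {x : ℝ} (hx : 0 < x) : 0 < (x⁻¹)^2 * expNegInvGlue x :=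
  mul_pos (by positivity) (expNegInvGlue.pos_of_pos hx)

lemma S_deriv_bound : ∃ K : ℝ, 0 < K ∧ ∀ x, |deriv smoothTransition x| ≤ K := by
  have hc : Continuous (deriv smoothTransition) :=
    (Real.smoothTransition.contDiff (n := 1)).continuous_deriv le_rfl
  obtain ⟨K, hK⟩ := isCompact_Icc.exists_bound_of_continuousOn (s := Icc (-1:ℝ) 2) hc.continuousOn
  refine ⟨max K 1, by positivity, fun x => ?_⟩
  by_cases hx : x ∈ Icc (-1:ℝ) 2
  · exact (hK x hx).trans (le_max_left _ _)
  · have : deriv smoothTransition x = 0 := by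
      simp only [mem_Icc, not_and_or, not_le] at hx
      rcases hx with hx | hx
      · have : smoothTransition =ᶠ[𝓝 x] fun _ => 0 := by
          filter_upwards [Iio_mem_nhds hx] with y hy
          exact smoothTransition.zero_of_nonpos (by linarith [mem_Iio.1 hy])
        rw [this.deriv_eq]; simp
      · have : smoothTransition =ᶠ[𝓝 x] fun _ => 1 := by
          filter_upwards [Ioi_mem_nhds hx] with y hy
          exact smoothTransition.one_of_one_le (by linarith [mem_Ioi.1 hy])
        rw [this.deriv_eq]; simp
    rw [this]; simp

lemma abs_le_dist1 (z p : ℝ × ℝ) : |z.1 - p.1| ≤ dist z p := by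
  rw [Prod.dist_eq, ← Real.dist_eq]; exact le_max_left _ _
lemma abs_le_dist2 (z p : ℝ × ℝ) : |z.2 - p.2| ≤ dist z p := by
  rw [Prod.dist_eq, ← Real.dist_eq]; exact le_max_right _ _
lemma dist_sq_le (z p : ℝ × ℝ) : dist z p ^ 2 ≤ (z.1 - p.1)^2 + (z.2 - p.2)^2 := by
  rw [Prod.dist_eq, Real.dist_eq, Real.dist_eq]
  rcases max_cases |z.1 - p.1| |z.2 - p.2| with h | h <;> rw [h.1, sq_abs] <;> nlinarith [sq_nonneg (z.1 - p.1), sq_nonneg (z.2 - p.2)]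

lemma cutoff_one (p : ℝ × ℝ) (K : Set (ℝ × ℝ)) (hK : IsClosed K) (hp : p ∉ K)
    (δ : ℝ) (hδ : 0 < δ) : ∃ η : ℝ × ℝ → ℝ, ContDiff ℝ 1 η ∧ (∀ z, 0 ≤ η z) ∧ (∀ z, η z ≤ 1) ∧
      (∀ᶠ z in 𝓝 p, η z = 0) ∧ (∀ z ∈ K, η z = 1) ∧
      Integrable (fun z => ‖fderiv ℝ η z‖) ∧ ∫ z, ‖fderiv ℝ η z‖ ≤ δ := by
  obtain ⟨d, hd, hdK⟩ := Metric.isOpen_iff.1 hK.isOpen_compl p hp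
  obtain ⟨B, hB, hBd⟩ := S_deriv_bound
  set r := min (d/2) (δ / (128 * B)) with hr
  have hr0 : 0 < r := by positivity
  have hrd : r ≤ d/2 := min_le_left _ _
  have hrδ : 128 * B * r ≤ δ := by
    have : r ≤ δ / (128 * B) := min_le_right _ _
    rw [le_div_iff₀ (by positivity)] at this
    linarith
  let f : ℝ × ℝ → ℝ := fun z => ((z.1 - p.1)^2 + (z.2 - p.2)^2) / r^2 - 1
  let η : ℝ × ℝ → ℝ := fun z => smoothTransition (f z)
  have hf : ContDiff ℝ 1 f := by fun_prop
  have hη : ContDiff ℝ 1 η := (Real.smoothTransition.contDiff (n := 1)).comp hf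
  have hbound : ∀ z, ‖fderiv ℝ η z‖ ≤ (Metric.closedBall p (2*r)).indicator (fun _ => 8 * B / r) z := by
    intro z
    by_cases hz : z ∈ Metric.closedBall p (2*r)
    · rw [indicator_of_mem hz]
      rw [Metric.mem_closedBall] at hz
      have h1 := (abs_le_dist1 z p).trans hz
      have h2 := (abs_le_dist2 z p).trans hz
      have hfst : HasFDerivAt (fun z : ℝ × ℝ => z.1 - p.1) (ContinuousLinearMap.fst ℝ ℝ ℝ) z :=
        hasFDerivAt_fst.sub_const _
      have hsnd : HasFDerivAt (fun z : ℝ × ℝ => z.2 - p.2) (ContinuousLinearMap.snd ℝ ℝ ℝ) z :=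
        hasFDerivAt_snd.sub_const _
      have hfd := (((hfst.pow 2).add (hsnd.pow 2)).mul_const ((r^2)⁻¹)).sub_const 1
      have hS : HasDerivAt smoothTransition (deriv smoothTransition (f z)) (f z) :=
        ((Real.smoothTransition.contDiff (n := 1)).differentiable one_ne_zero _).hasDerivAt
      have hηd : HasFDerivAt η _ z := hS.comp_hasFDerivAt z hfd
      rw [hηd.fderiv]
      rw [norm_smul, norm_smul, Real.norm_eq_abs]
      have hn : ‖((2:ℕ) • (z.1 - p.1) ^ (2 - 1) : ℝ) • ContinuousLinearMap.fst ℝ ℝ ℝ + ((2:ℕ) • (z.2 - p.2) ^ (2 - 1) : ℝ) • ContinuousLinearMap.snd ℝ ℝ ℝ‖ ≤ 8 * r := by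
        refine (norm_add_le _ _).trans ?_
        rw [norm_smul ((2:ℕ) • (z.1 - p.1) ^ (2 - 1) : ℝ), norm_smul ((2:ℕ) • (z.2 - p.2) ^ (2 - 1) : ℝ)]
        have e1 : ‖((2:ℕ) • (z.1 - p.1) ^ (2 - 1) : ℝ)‖ ≤ 4 * r := by
          simp; linarith
        have e2 : ‖((2:ℕ) • (z.2 - p.2) ^ (2 - 1) : ℝ)‖ ≤ 4 * r := by
          simp; linarith
        have e3 := ContinuousLinearMap.norm_fst_le ℝ ℝ ℝ
        have e4 := ContinuousLinearMap.norm_snd_le ℝ ℝ ℝ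
        have := mul_le_mul e1 e3 (norm_nonneg _) (by positivity)
        have := mul_le_mul e2 e4 (norm_nonneg _) (by positivity)
        linarith
      have h3 : ‖((r^2)⁻¹ : ℝ)‖ = (r^2)⁻¹ := by rw [Real.norm_of_nonneg]; positivity
      rw [h3]
      calc _ ≤ B * ((r^2)⁻¹ * (8 * r)) := by gcongr; exact hBd _
        _ = 8 * B / r := by field_simp
    · rw [indicator_of_notMem hz]
      rw [Metric.mem_closedBall, not_le] at hz
      have : η =ᶠ[𝓝 z] fun _ => 1 := by
        have : ∀ᶠ w in 𝓝 z, 2 * r < dist w p :=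
          (continuous_id.dist continuous_const).continuousAt.eventually (lt_mem_nhds hz)
        filter_upwards [this] with w hw
        apply smoothTransition.one_of_one_le
        have := dist_sq_le w p
        show 1 ≤ ((w.1 - p.1)^2 + (w.2 - p.2)^2) / r^2 - 1
        rw [le_sub_iff_add_le, le_div_iff₀ (by positivity)]
        nlinarith
      rw [this.fderiv_eq]; simp
  have hvol : volume.real (Metric.closedBall p (2*r)) = 16 * r^2 := by
    rw [← closedBall_prod_same, Measure.volume_eq_prod, Measure.real, Measure.prod_prod,
      Real.volume_closedBall, Real.volume_closedBall, ENNReal.toReal_mul,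
      ENNReal.toReal_ofReal (by positivity)]
    ring
  have hfin : volume (Metric.closedBall p (2*r)) ≠ ⊤ := (isCompact_closedBall _ _).measure_lt_top.ne
  have hindi : Integrable ((Metric.closedBall p (2*r)).indicator (fun _ => 8 * B / r)) :=
    (integrableOn_const hfin).integrable_indicator measurableSet_closedBall
  have hint : Integrable (fun z => ‖fderiv ℝ η z‖) := by
    refine hindi.mono' (hη.continuous_fderiv one_ne_zero).norm.aestronglyMeasurable (ae_of_all _ fun z => ?_)
    simpa using hbound z
  refine ⟨η, hη, fun z => smoothTransition.nonneg _, fun z => smoothTransition.le_one _, ?_, ?_, hint, ?_⟩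
  · have hfp : f p < 0 := by simp [f]
    filter_upwards [hf.continuous.continuousAt.eventually (gt_mem_nhds hfp)] with z hz
    exact smoothTransition.zero_of_nonpos hz.le
  · intro z hz
    apply smoothTransition.one_of_one_le
    have h1 : d ≤ dist z p := by
      by_contra h
      exact hdK (Metric.mem_ball.2 (not_le.1 h)) hz
    have := dist_sq_le z p
    show 1 ≤ ((z.1 - p.1)^2 + (z.2 - p.2)^2) / r^2 - 1
    rw [le_sub_iff_add_le, le_div_iff₀ (by positivity)]
    nlinarith
  · calc _ ≤ ∫ z, (Metric.closedBall p (2*r)).indicator (fun _ => 8 * B / r) z :=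
          integral_mono hint hindi hbound
      _ = 128 * B * r := by
          rw [integral_indicator measurableSet_closedBall, setIntegral_const, hvol, smul_eq_mul]
          field_simp; norm_num
      _ ≤ δ := hrδ

lemma cutoff_many (P : Set (ℝ × ℝ)) (hP : P.Finite) (K : Set (ℝ × ℝ)) (hK : IsClosed K)
    (hPK : Disjoint P K) : ∀ δ : ℝ, 0 < δ →
    ∃ η : ℝ × ℝ → ℝ, ContDiff ℝ 1 η ∧ (∀ z, 0 ≤ η z) ∧ (∀ z, η z ≤ 1) ∧
      (∀ p ∈ P, ∀ᶠ z in 𝓝 p, η z = 0) ∧ (∀ z ∈ K, η z = 1) ∧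
      Integrable (fun z => ‖fderiv ℝ η z‖) ∧ ∫ z, ‖fderiv ℝ η z‖ ≤ δ := by
  induction P, hP using Set.Finite.induction_on with
  | empty =>
    intro δ hδ
    exact ⟨fun _ => 1, contDiff_const, by simp, by simp, by simp, by simp, by simp, by simpa using hδ.le⟩
  | @insert p P hp hP ih =>
    intro δ hδ
    rw [disjoint_insert_left] at hPK
    obtain ⟨η, h1, h2, h3, h4, h5, h6, h7⟩ := ih hPK.2 (δ/2) (by positivity)
    obtain ⟨θ, g1, g2, g3, g4, g5, g6, g7⟩ := cutoff_one p K hK hPK.1 (δ/2) (by positivity)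
    have hb : ∀ z, ‖fderiv ℝ (fun z => η z * θ z) z‖ ≤ ‖fderiv ℝ η z‖ + ‖fderiv ℝ θ z‖ := by
      intro z
      have e1 := (h1.differentiable one_ne_zero z).hasFDerivAt
      have e2 := (g1.differentiable one_ne_zero z).hasFDerivAt
      rw [show (fun z => η z * θ z) = η * θ from rfl, (e1.mul e2).fderiv]
      refine (norm_add_le _ _).trans ?_
      rw [norm_smul, norm_smul, Real.norm_of_nonneg (h2 z), Real.norm_of_nonneg (g2 z)]
      have := mul_le_mul_of_nonneg_right (h3 z) (norm_nonneg (fderiv ℝ θ z))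
      have := mul_le_mul_of_nonneg_right (g3 z) (norm_nonneg (fderiv ℝ η z))
      linarith
    have hc := h1.mul g1
    have hint : Integrable (fun z => ‖fderiv ℝ (fun z => η z * θ z) z‖) := by
      refine (h6.add g6).mono' (hc.continuous_fderiv one_ne_zero).norm.aestronglyMeasurable (ae_of_all _ fun z => ?_)
      simpa using hb z
    refine ⟨fun z => η z * θ z, hc, fun z => mul_nonneg (h2 z) (g2 z),
      fun z => mul_le_one₀ (h3 z) (g2 z) (g3 z), ?_, fun z hz => by simp [h5 z hz, g5 z hz], hint, ?_⟩
    · rintro q (rfl | hq)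
      · filter_upwards [g4] with z hz; simp [hz]
      · filter_upwards [h4 q hq] with z hz; simp [hz]
    · calc _ ≤ ∫ z, (‖fderiv ℝ η z‖ + ‖fderiv ℝ θ z‖) := integral_mono hint (h6.add g6) hb
        _ = _ := integral_add h6 g6
        _ ≤ δ := by linarith

lemma integral_fderiv_zero (G : ℝ × ℝ → ℝ) (hG : ContDiff ℝ 1 G) (hs : HasCompactSupport G) (v : ℝ × ℝ) :
    Integrable (fun z => fderiv ℝ G z v) ∧ ∫ z, fderiv ℝ G z v = 0 := by
  have hc : Continuous (fun z => fderiv ℝ G z v) := (hG.continuous_fderiv one_ne_zero).clm_apply continuous_const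
  have hi : Integrable (fun z => fderiv ℝ G z v) := hc.integrable_of_hasCompactSupport (hs.fderiv_apply (𝕜 := ℝ) v)
  refine ⟨hi, ?_⟩
  have := integral_mul_fderiv_eq_neg_fderiv_mul_of_integrable (𝕜 := ℝ) (μ := (volume : Measure (ℝ × ℝ))) (f := fun _ => 1) (g := G) (v := v)
    (by simp) (by simpa using hi) (by simpa using hG.continuous.integrable_of_hasCompactSupport hs)
    (by simp) (fun x _ => hG.differentiable one_ne_zero x)
  simpa using this

/-! algebra -/
lemma cs_W (p q a b W U : ℝ) (hW : 0 < W) (hU : 0 < U) (hW2 : W^2 = 1 + p^2 + q^2) (hU2 : U^2 = 1 + a^2 + b^2) :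
    1 + p*a + q*b ≤ W*U := by
  apply le_of_sq_le_sq _ (by positivity)
  rw [mul_pow, hW2, hU2]
  nlinarith [sq_nonneg (p-a), sq_nonneg (q-b), sq_nonneg (p*b-q*a)]

lemma cs_W_strict (p q a b W U : ℝ) (hW : 0 < W) (hU : 0 < U) (hW2 : W^2 = 1 + p^2 + q^2) (hU2 : U^2 = 1 + a^2 + b^2)
    (hne : ¬ (p = a ∧ q = b)) :
    1 + p*a + q*b < W*U := by
  apply lt_of_pow_lt_pow_left₀ 2 (by positivity)
  rw [mul_pow, hW2, hU2]
  have : 0 < (p-a)^2 + (q-b)^2 := by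
    rcases not_and_or.1 hne with h | h
    · have := sq_pos_of_ne_zero (sub_ne_zero.2 h); positivity
    · have := sq_pos_of_ne_zero (sub_ne_zero.2 h); positivity
  nlinarith [sq_nonneg (p*b-q*a)]

lemma mono_id (p q a b W U : ℝ) (hW : 0 < W) (hU : 0 < U) (hW2 : W^2 = 1 + p^2 + q^2) (hU2 : U^2 = 1 + a^2 + b^2) :
    (p - a) * (p/W - a/U) + (q - b) * (q/W - b/U) = (W + U) / (W*U) * (W*U - (1 + p*a + q*b)) := by
  have e1 : q^2 = W^2 - 1 - p^2 := by linarith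
  have e2 : b^2 = U^2 - 1 - a^2 := by linarith
  field_simp
  ring_nf
  rw [e1, e2]
  ring

lemma one_side (p q a b W U : ℝ) (hW : 1 ≤ W) (hU : 1 ≤ U) (hW2 : W^2 = 1 + p^2 + q^2) (hU2 : U^2 = 1 + a^2 + b^2) :
    a * (p/W - a/U) + b * (q/W - b/U) ≤ 1 := by
  have h := cs_W p q a b W U (by linarith) (by linarith) hW2 hU2
  have hW0 : 0 < W := by linarith
  have hU0 : 0 < U := by linarith
  have h1 : (a*p + b*q)/W ≤ U := by
    rw [div_le_iff₀ hW0]; linarith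
  have h2 : (a^2+b^2)/U = U - 1/U := by
    field_simp; linarith
  have h3 : 1/U ≤ 1 := by rw [div_le_one hU0]; exact hU
  have : a * (p/W - a/U) + b * (q/W - b/U) = (a*p + b*q)/W - (a^2+b^2)/U := by ring
  linarith

lemma comp_le (p W : ℝ) (hW : 0 < W) (h : p^2 ≤ W^2) : |p / W| ≤ 1 := by
  rw [abs_div, abs_of_pos hW, div_le_one hW]
  exact abs_le_of_sq_le_sq h hW.le

lemma pd1_eq {u : ℝ × ℝ → ℝ} {z : ℝ × ℝ} (h : DifferentiableAt ℝ u z) : pd1 u z = fderiv ℝ u z (1, 0) := by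
  have hc : HasDerivAt (fun t : ℝ => (t, z.2)) ((1:ℝ), (0:ℝ)) z.1 :=
    (hasDerivAt_id z.1).prodMk (hasDerivAt_const _ _)
  exact (HasFDerivAt.comp_hasDerivAt z.1 (f := fun t : ℝ => (t, z.2)) (l := u) h.hasFDerivAt hc).deriv

lemma pd2_eq {u : ℝ × ℝ → ℝ} {z : ℝ × ℝ} (h : DifferentiableAt ℝ u z) : pd2 u z = fderiv ℝ u z (0, 1) := by
  have hc : HasDerivAt (fun t : ℝ => (z.1, t)) ((0:ℝ), (1:ℝ)) z.2 :=
    (hasDerivAt_const _ _).prodMk (hasDerivAt_id z.2)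
  exact (HasFDerivAt.comp_hasDerivAt z.2 (f := fun t : ℝ => (z.1, t)) (l := u) h.hasFDerivAt hc).deriv

lemma Wg_sq (u : ℝ × ℝ → ℝ) (z : ℝ × ℝ) : Wg u z ^ 2 = 1 + pd1 u z ^ 2 + pd2 u z ^ 2 :=
  Real.sq_sqrt (by positivity)

lemma Wg_ge (u : ℝ × ℝ → ℝ) (z : ℝ × ℝ) : 1 ≤ Wg u z := by
  rw [Wg, Real.one_le_sqrt]; nlinarith [sq_nonneg (pd1 u z), sq_nonneg (pd2 u z)]

lemma pd_contDiffOn {Ω : Set (ℝ × ℝ)} (hΩ : IsOpen Ω) {u : ℝ × ℝ → ℝ} (hu : ContDiffOn ℝ 2 u Ω) :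
    ContDiffOn ℝ 1 (pd1 u) Ω ∧ ContDiffOn ℝ 1 (pd2 u) Ω := by
  have hd : ∀ z ∈ Ω, DifferentiableAt ℝ u z := fun z hz =>
    (hu.differentiableOn two_ne_zero).differentiableAt (hΩ.mem_nhds hz)
  have h := hu.fderiv_of_isOpen (m := 1) hΩ (by norm_num)
  exact ⟨(h.clm_apply contDiffOn_const).congr fun z hz => pd1_eq (hd z hz),
    (h.clm_apply contDiffOn_const).congr fun z hz => pd2_eq (hd z hz)⟩

lemma mse_div {Ω : Set (ℝ × ℝ)} (hΩ : IsOpen Ω) {u : ℝ × ℝ → ℝ} (hu : IsMSE u Ω) :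
    ContDiffOn ℝ 1 (fun z => pd1 u z / Wg u z) Ω ∧ ContDiffOn ℝ 1 (fun z => pd2 u z / Wg u z) Ω ∧
    ∀ z ∈ Ω, fderiv ℝ (fun z => pd1 u z / Wg u z) z (1, 0) +
      fderiv ℝ (fun z => pd2 u z / Wg u z) z (0, 1) = 0 := by
  obtain ⟨hu2, hm⟩ := hu
  obtain ⟨hp, hq⟩ := pd_contDiffOn hΩ hu2
  have hd : ∀ z ∈ Ω, DifferentiableAt ℝ u z := fun z hz =>
    (hu2.differentiableOn two_ne_zero).differentiableAt (hΩ.mem_nhds hz)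
  have hW : ContDiffOn ℝ 1 (Wg u) Ω := by
    refine ContDiffOn.sqrt ((contDiffOn_const.add (hp.pow 2)).add (hq.pow 2)) fun z _ => ?_
    have : 0 < 1 + pd1 u z ^ 2 + pd2 u z ^ 2 := by positivity
    exact this.ne'
  have hW0 : ∀ z, Wg u z ≠ 0 := fun z => by linarith [Wg_ge u z] |> fun (h : 0 < Wg u z) => h.ne'
  refine ⟨hp.div hW fun z _ => hW0 z, hq.div hW fun z _ => hW0 z, fun z hz => ?_⟩
  have hpd := (hp.differentiableOn one_ne_zero).differentiableAt (hΩ.mem_nhds hz)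
  have hqd := (hq.differentiableOn one_ne_zero).differentiableAt (hΩ.mem_nhds hz)
  have hWd := (hW.differentiableOn one_ne_zero).differentiableAt (hΩ.mem_nhds hz)
  have hM := hm z hz
  rw [pd1_eq hpd, pd2_eq hpd, pd2_eq hqd] at hM
  -- symmetry
  have hsymm : fderiv ℝ (pd2 u) z (1, 0) = fderiv ℝ (pd1 u) z (0, 1) := by
    have hs : IsSymmSndFDerivAt ℝ u z :=
      (hu2.contDiffAt (hΩ.mem_nhds hz)).isSymmSndFDerivAt (by simp)
    have hfd : DifferentiableAt ℝ (fderiv ℝ u) z :=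
      ((hu2.fderiv_of_isOpen (m := 1) hΩ (by norm_num)).differentiableOn one_ne_zero).differentiableAt (hΩ.mem_nhds hz)
    have e1 : pd1 u =ᶠ[𝓝 z] fun w => fderiv ℝ u w (1, 0) := by
      filter_upwards [hΩ.mem_nhds hz] with w hw using pd1_eq (hd w hw)
    have e2 : pd2 u =ᶠ[𝓝 z] fun w => fderiv ℝ u w (0, 1) := by
      filter_upwards [hΩ.mem_nhds hz] with w hw using pd2_eq (hd w hw)
    rw [e1.fderiv_eq, e2.fderiv_eq, fderiv_clm_apply hfd (by fun_prop), fderiv_clm_apply hfd (by fun_prop)]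
    simpa using hs (1, 0) (0, 1)
  have hWW : ∀ v, Wg u z * fderiv ℝ (Wg u) z v = pd1 u z * fderiv ℝ (pd1 u) z v + pd2 u z * fderiv ℝ (pd2 u) z v := by
    intro v
    have hEq : (fun w => Wg u w ^ 2) = fun w => 1 + pd1 u w ^ 2 + pd2 u w ^ 2 := funext (Wg_sq u)
    have h1 : HasFDerivAt (fun w => Wg u w ^ 2) _ z := hWd.hasFDerivAt.pow 2
    have h2 : HasFDerivAt (fun w => 1 + pd1 u w ^ 2 + pd2 u w ^ 2) _ z :=
      ((hpd.hasFDerivAt.pow 2).const_add 1).add (hqd.hasFDerivAt.pow 2)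
    rw [hEq] at h1
    have := congrArg (fun L => L v) (h1.unique h2)
    simp at this
    linarith
  have hdiv : ∀ (f : ℝ × ℝ → ℝ) (v : ℝ × ℝ), DifferentiableAt ℝ f z →
      fderiv ℝ (fun w => f w / Wg u w) z v = fderiv ℝ f z v / Wg u z - f z * (Wg u z * fderiv ℝ (Wg u) z v) / Wg u z ^ 3 := by
    intro f v hf
    have h0 := hW0 z
    have h1 : DifferentiableAt ℝ (fun w => f w / Wg u w) z := by
      simpa only [div_eq_mul_inv] using hf.fun_mul (hWd.fun_inv h0)
    have h2 : HasFDerivAt (fun w => f w / Wg u w * Wg u w) _ z := h1.hasFDerivAt.mul hWd.hasFDerivAt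
    have h3 : (fun w => f w / Wg u w * Wg u w) = f := by
      funext w; exact div_mul_cancel₀ _ (hW0 w)
    rw [h3] at h2
    have := congrArg (fun L => L v) h2.fderiv
    simp at this
    rw [this]
    field_simp
    ring
  rw [hdiv _ _ hpd, hdiv _ _ hqd, hWW, hWW, hsymm]
  have h0 := hW0 z
  have hsq := Wg_sq u z
  field_simp
  rw [hsq]
  linear_combination hM

lemma extend_zero {Ω : Set (ℝ × ℝ)} (hΩ : IsOpen Ω) (hb : Bornology.IsBounded Ω) {F : ℝ × ℝ → ℝ}
    (hF : ContDiffOn ℝ 1 F Ω) (h0 : ∀ z ∈ frontier Ω, ∀ᶠ w in 𝓝[Ω] z, F w = 0) :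
    ContDiff ℝ 1 (Ω.indicator F) ∧ HasCompactSupport (Ω.indicator F) ∧
    (∀ z ∈ Ω, fderiv ℝ (Ω.indicator F) z = fderiv ℝ F z) ∧
    (∀ z, z ∉ Ω → fderiv ℝ (Ω.indicator F) z = 0) := by
  have hin : ∀ z ∈ Ω, Ω.indicator F =ᶠ[𝓝 z] F := fun z hz => by
    filter_upwards [hΩ.mem_nhds hz] with w hw using indicator_of_mem hw F
  have hout : ∀ z, z ∉ Ω → Ω.indicator F =ᶠ[𝓝 z] fun _ => 0 := by
    intro z hz
    by_cases hc : z ∈ closure Ω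
    · have hf : z ∈ frontier Ω := ⟨hc, by rwa [hΩ.interior_eq]⟩
      have := eventually_nhdsWithin_iff.1 (h0 z hf)
      filter_upwards [this] with w hw
      by_cases hw' : w ∈ Ω
      · rw [indicator_of_mem hw', hw hw']
      · exact indicator_of_notMem hw' F
    · filter_upwards [isClosed_closure.isOpen_compl.mem_nhds hc] with w hw
      exact indicator_of_notMem (fun h => hw (subset_closure h)) F
  refine ⟨contDiff_iff_contDiffAt.2 fun z => ?_, ?_, fun z hz => (hin z hz).fderiv_eq, fun z hz => ?_⟩
  · by_cases hz : z ∈ Ω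
    · exact (hF.contDiffAt (hΩ.mem_nhds hz)).congr_of_eventuallyEq (hin z hz)
    · exact contDiffAt_const.congr_of_eventuallyEq (hout z hz)
  · refine HasCompactSupport.of_support_subset_isCompact hb.isCompact_closure ?_
    exact (support_indicator_subset).trans subset_closure
  · rw [(hout z hz).fderiv_eq]; simp

lemma div_int {Ω : Set (ℝ × ℝ)} (hΩ : IsOpen Ω) (hb : Bornology.IsBounded Ω) {F G : ℝ × ℝ → ℝ}
    (hF : ContDiffOn ℝ 1 F Ω) (hF0 : ∀ z ∈ frontier Ω, ∀ᶠ w in 𝓝[Ω] z, F w = 0)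
    (hG : ContDiffOn ℝ 1 G Ω) (hG0 : ∀ z ∈ frontier Ω, ∀ᶠ w in 𝓝[Ω] z, G w = 0)
    {L : ℝ × ℝ → ℝ} (hL : Integrable L)
    (hin : ∀ z ∈ Ω, L z ≤ fderiv ℝ F z (1, 0) + fderiv ℝ G z (0, 1))
    (hout : ∀ z, z ∉ Ω → L z ≤ 0) : ∫ z, L z ≤ 0 := by
  obtain ⟨f1, f2, f3, f4⟩ := extend_zero hΩ hb hF hF0
  obtain ⟨g1, g2, g3, g4⟩ := extend_zero hΩ hb hG hG0
  obtain ⟨fi, f0⟩ := integral_fderiv_zero _ f1 f2 (1, 0)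
  obtain ⟨gi, g0⟩ := integral_fderiv_zero _ g1 g2 (0, 1)
  calc ∫ z, L z ≤ ∫ z, (fderiv ℝ (Ω.indicator F) z (1, 0) + fderiv ℝ (Ω.indicator G) z (0, 1)) := by
        refine integral_mono hL (fi.add gi) fun z => ?_
        by_cases hz : z ∈ Ω
        · simpa [f3 z hz, g3 z hz] using hin z hz
        · simpa [f4 z hz, g4 z hz] using hout z hz
    _ = 0 := by rw [integral_add fi gi, f0, g0, add_zero]

/-- Pointwise algebraic lower bound. -/
lemma pointwise_alg (η e a b e' a' b' M N ηx ηy p q r s X Y : ℝ) (hM : 0 < M)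
    (hη : 0 ≤ η) (hη1 : η ≤ 1) (he : 0 ≤ e) (he1 : e ≤ 1) (ha : 0 ≤ a) (ha1 : a ≤ 1) (hb : 0 ≤ b) (hb1 : b ≤ 1)
    (ha' : 0 ≤ a') (ha1' : a' ≤ 1) (hb' : 0 ≤ b') (hb1' : b' ≤ 1)
    (hx : |ηx| ≤ N) (hy : |ηy| ≤ N) (hX : |X| ≤ 2) (hY : |Y| ≤ 2)
    (h1 : r * X + s * Y ≤ 1) (h2 : -1 ≤ p * X + q * Y) :
    η * a * b * (e' * ((p - r) * X + (q - s) * Y)) - 2 / M - 4 * N ≤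
      (ηx * e * a * b + η * (e' * (p - r)) * a * b + η * e * (a' * (-r / M)) * b + η * e * a * (b' * (p / M))) * X
      + (ηy * e * a * b + η * (e' * (q - s)) * a * b + η * e * (a' * (-s / M)) * b + η * e * a * (b' * (q / M))) * Y := by
  have k1 : 0 ≤ e * a * b := by positivity
  have k1' : e * a * b ≤ 1 := mul_le_one₀ (mul_le_one₀ he1 ha ha1) hb hb1
  have k2 : 0 ≤ η * e * a' * b := by positivity
  have k2' : η * e * a' * b ≤ 1 := mul_le_one₀ (mul_le_one₀ (mul_le_one₀ hη1 he he1) ha' ha1') hb hb1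
  have k3 : 0 ≤ η * e * a * b' := by positivity
  have k3' : η * e * a * b' ≤ 1 := mul_le_one₀ (mul_le_one₀ (mul_le_one₀ hη1 he he1) ha ha1) hb' hb1'
  have hN : 0 ≤ N := (abs_nonneg _).trans hx
  have m1 : -(4 * N) ≤ (e * a * b) * (ηx * X + ηy * Y) := by
    have n1 : |ηx * X| ≤ N * 2 := by rw [abs_mul]; gcongr
    have n2 : |ηy * Y| ≤ N * 2 := by rw [abs_mul]; gcongr
    have n3 := abs_le.1 n1
    have n4 := abs_le.1 n2
    nlinarith
  have m2 : -(1 / M) ≤ (η * e * a' * b) * (-(r * X + s * Y) / M) := by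
    have : -(1 / M) ≤ -(r * X + s * Y) / M := by
      rw [← neg_div]; gcongr
    have hm : 0 < 1 / M := by positivity
    nlinarith
  have m3 : -(1 / M) ≤ (η * e * a * b') * ((p * X + q * Y) / M) := by
    have : -(1 / M) ≤ (p * X + q * Y) / M := by
      rw [← neg_div]; gcongr
    have hm : 0 < 1 / M := by positivity
    nlinarith
  have : (ηx * e * a * b + η * (e' * (p - r)) * a * b + η * e * (a' * (-r / M)) * b + η * e * a * (b' * (p / M))) * X
      + (ηy * e * a * b + η * (e' * (q - s)) * a * b + η * e * (a' * (-s / M)) * b + η * e * a * (b' * (q / M))) * Y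
      = η * a * b * (e' * ((p - r) * X + (q - s) * Y)) + (e * a * b) * (ηx * X + ηy * Y)
        + (η * e * a' * b) * (-(r * X + s * Y) / M) + (η * e * a * b') * ((p * X + q * Y) / M) := by ring
  rw [this]
  have : 2 / M = 1 / M + 1 / M := by ring
  linarith

lemma g_deriv (η u₁ u₂ X : ℝ × ℝ → ℝ) (z : ℝ × ℝ) (M ε : ℝ) (v : ℝ × ℝ)
    (hη : DifferentiableAt ℝ η z) (D1 : DifferentiableAt ℝ u₁ z) (D2 : DifferentiableAt ℝ u₂ z)
    (hX : DifferentiableAt ℝ X z) :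
    fderiv ℝ (fun w => η w * expNegInvGlue (u₁ w - u₂ w - ε) * expNegInvGlue (1 - u₂ w / M) * expNegInvGlue (1 + u₁ w / M) * X w) z v
    = (fderiv ℝ η z v * expNegInvGlue (u₁ z - u₂ z - ε) * expNegInvGlue (1 - u₂ z / M) * expNegInvGlue (1 + u₁ z / M)
      + η z * (deriv expNegInvGlue (u₁ z - u₂ z - ε) * (fderiv ℝ u₁ z v - fderiv ℝ u₂ z v)) * expNegInvGlue (1 - u₂ z / M) * expNegInvGlue (1 + u₁ z / M)
      + η z * expNegInvGlue (u₁ z - u₂ z - ε) * (deriv expNegInvGlue (1 - u₂ z / M) * (- fderiv ℝ u₂ z v / M)) * expNegInvGlue (1 + u₁ z / M)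
      + η z * expNegInvGlue (u₁ z - u₂ z - ε) * expNegInvGlue (1 - u₂ z / M) * (deriv expNegInvGlue (1 + u₁ z / M) * (fderiv ℝ u₁ z v / M))) * X z
      + η z * expNegInvGlue (u₁ z - u₂ z - ε) * expNegInvGlue (1 - u₂ z / M) * expNegInvGlue (1 + u₁ z / M) * fderiv ℝ X z v := by
  have hE : ∀ t, HasDerivAt expNegInvGlue (deriv expNegInvGlue t) t := fun t =>
    (E_hasDeriv t).differentiableAt.hasDerivAt
  have F1 : HasFDerivAt (fun w => expNegInvGlue (u₁ w - u₂ w - ε)) _ z :=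
    (hE _).comp_hasFDerivAt z ((D1.hasFDerivAt.fun_sub D2.hasFDerivAt).sub_const ε)
  have F2 : HasFDerivAt (fun w => expNegInvGlue (1 - u₂ w * M⁻¹)) _ z :=
    (hE _).comp_hasFDerivAt z ((D2.hasFDerivAt.mul_const M⁻¹).const_sub 1)
  have F3 : HasFDerivAt (fun w => expNegInvGlue (1 + u₁ w * M⁻¹)) _ z :=
    (hE _).comp_hasFDerivAt z ((D1.hasFDerivAt.mul_const M⁻¹).const_add 1)
  have Fg := (((hη.hasFDerivAt.fun_mul F1).fun_mul F2).fun_mul F3).fun_mul hX.hasFDerivAt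
  simp only [div_eq_mul_inv]
  rw [Fg.fderiv]
  simp only [_root_.add_apply, _root_.smul_apply, _root_.sub_apply, _root_.neg_apply, smul_eq_mul]
  ring

set_option maxHeartbeats 2000000 in
lemma key {Ω : Set (ℝ × ℝ)} (hΩ : IsOpen Ω) (hb : Bornology.IsBounded Ω) {u₁ u₂ : ℝ × ℝ → ℝ}
    (h₁ : IsMSE u₁ Ω) (h₂ : IsMSE u₂ Ω) (P : Set (ℝ × ℝ)) (hP : P.Finite) (hPΩ : Disjoint P Ω)
    (hbd : ∀ z ∈ frontier Ω, z ∈ P ∨ Tendsto u₂ (𝓝[Ω] z) atTop ∨ Tendsto u₁ (𝓝[Ω] z) atBot ∨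
      Tendsto (fun w => u₁ w - u₂ w) (𝓝[Ω] z) (𝓝 0))
    {z₀ : ℝ × ℝ} (hz₀ : z₀ ∈ Ω) (hpos : 0 < u₁ z₀ - u₂ z₀) :
    pd1 u₁ z₀ = pd1 u₂ z₀ ∧ pd2 u₁ z₀ = pd2 u₂ z₀ := by
  by_contra hne
  set E := expNegInvGlue with hE
  have hEc : ContDiff ℝ 1 E := expNegInvGlue.contDiff (n := 1)
  let X : ℝ × ℝ → ℝ := fun z => pd1 u₁ z / Wg u₁ z - pd1 u₂ z / Wg u₂ z
  let Y : ℝ × ℝ → ℝ := fun z => pd2 u₁ z / Wg u₁ z - pd2 u₂ z / Wg u₂ z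
  obtain ⟨c1, c2, d1⟩ := mse_div hΩ h₁
  obtain ⟨c3, c4, d2⟩ := mse_div hΩ h₂
  have hXc : ContDiffOn ℝ 1 X Ω := c1.sub c3
  have hYc : ContDiffOn ℝ 1 Y Ω := c2.sub c4
  have hdiff : ∀ {F : ℝ × ℝ → ℝ}, ContDiffOn ℝ 1 F Ω → ∀ z ∈ Ω, DifferentiableAt ℝ F z := fun hF z hz =>
    (hF.differentiableOn one_ne_zero).differentiableAt (hΩ.mem_nhds hz)
  have hXY : ∀ z ∈ Ω, fderiv ℝ X z (1, 0) + fderiv ℝ Y z (0, 1) = 0 := by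
    intro z hz
    have e1 : fderiv ℝ X z = _ := fderiv_sub (hdiff c1 z hz) (hdiff c3 z hz)
    have e2 : fderiv ℝ Y z = _ := fderiv_sub (hdiff c2 z hz) (hdiff c4 z hz)
    rw [e1, e2]
    have := d1 z hz
    have := d2 z hz
    simp only [_root_.sub_apply]
    linarith
  obtain ⟨p1, q1⟩ := pd_contDiffOn hΩ h₁.1
  obtain ⟨p2, q2⟩ := pd_contDiffOn hΩ h₂.1
  have hu₁ : ContDiffOn ℝ 1 u₁ Ω := h₁.1.of_le (by norm_num)
  have hu₂ : ContDiffOn ℝ 1 u₂ Ω := h₂.1.of_le (by norm_num)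
  set ε := (u₁ z₀ - u₂ z₀) / 2 with hε
  have hε0 : 0 < ε := by positivity
  have hWp : ∀ u z, 0 < Wg u z := fun u z => by linarith [Wg_ge u z]
  -- the monotone term
  let H : ℝ × ℝ → ℝ := fun z => deriv E (u₁ z - u₂ z - ε) *
    ((pd1 u₁ z - pd1 u₂ z) * X z + (pd2 u₁ z - pd2 u₂ z) * Y z)
  have hH0 : ∀ z, 0 ≤ H z := by
    intro z
    refine mul_nonneg ?_ ?_
    · rw [(E_hasDeriv _).deriv]; exact E_deriv_nonneg _
    · show 0 ≤ (pd1 u₁ z - pd1 u₂ z) * (pd1 u₁ z / Wg u₁ z - pd1 u₂ z / Wg u₂ z) + (pd2 u₁ z - pd2 u₂ z) * (pd2 u₁ z / Wg u₁ z - pd2 u₂ z / Wg u₂ z)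
      rw [mono_id _ _ _ _ _ _ (hWp u₁ z) (hWp u₂ z) (Wg_sq _ _) (Wg_sq _ _)]
      have := cs_W _ _ _ _ _ _ (hWp u₁ z) (hWp u₂ z) (Wg_sq u₁ z) (Wg_sq u₂ z)
      have := hWp u₁ z
      have := hWp u₂ z
      exact mul_nonneg (by positivity) (by linarith)
  have hHpos : 0 < H z₀ := by
    refine mul_pos ?_ ?_
    · rw [(E_hasDeriv _).deriv]; exact E_deriv_pos (by linarith)
    · show 0 < (pd1 u₁ z₀ - pd1 u₂ z₀) * (pd1 u₁ z₀ / Wg u₁ z₀ - pd1 u₂ z₀ / Wg u₂ z₀) + (pd2 u₁ z₀ - pd2 u₂ z₀) * (pd2 u₁ z₀ / Wg u₁ z₀ - pd2 u₂ z₀ / Wg u₂ z₀)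
      rw [mono_id _ _ _ _ _ _ (hWp u₁ z₀) (hWp u₂ z₀) (Wg_sq _ _) (Wg_sq _ _)]
      have := cs_W_strict _ _ _ _ _ _ (hWp u₁ z₀) (hWp u₂ z₀) (Wg_sq u₁ z₀) (Wg_sq u₂ z₀) hne
      have := hWp u₁ z₀
      have := hWp u₂ z₀
      exact mul_pos (by positivity) (by linarith)
  have hHc : ContinuousOn H Ω := by
    refine ((hEc.continuous_deriv le_rfl).comp_continuousOn
      ((hu₁.continuousOn.sub hu₂.continuousOn).sub continuousOn_const)).mul ?_
    exact ((p1.continuousOn.sub p2.continuousOn).mul hXc.continuousOn).add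
      ((q1.continuousOn.sub q2.continuousOn).mul hYc.continuousOn)
  set m := |u₁ z₀| + |u₂ z₀| + 1 with hm
  have hnear : ∀ᶠ z in 𝓝 z₀, z ∈ Ω ∧ H z₀ / 2 < H z ∧ |u₁ z| < m ∧ |u₂ z| < m := by
    have hO := hΩ.mem_nhds hz₀
    have a1 := (hHc.continuousAt hO).eventually (lt_mem_nhds (show H z₀ / 2 < H z₀ by linarith))
    have a2 := ((hu₁.continuousOn.continuousAt hO).abs).eventually
      (gt_mem_nhds (show |u₁ z₀| < m by have := abs_nonneg (u₂ z₀); linarith))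
    have a3 := ((hu₂.continuousOn.continuousAt hO).abs).eventually
      (gt_mem_nhds (show |u₂ z₀| < m by have := abs_nonneg (u₁ z₀); linarith))
    filter_upwards [hO, a1, a2, a3] with z w1 w2 w3 w4 using ⟨w1, w2, w3, w4⟩
  obtain ⟨ρ, hρ, hball⟩ := Metric.nhds_basis_closedBall.mem_iff.1 hnear
  set K := Metric.closedBall z₀ ρ with hK
  have hKΩ : K ⊆ Ω := fun z hz => (hball hz).1
  have hvK : 0 < volume.real K := by
    rw [Measure.real, ENNReal.toReal_pos_iff]
    exact ⟨Metric.measure_closedBall_pos _ _ hρ, (isCompact_closedBall _ _).measure_lt_top⟩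
  have hEh : 0 < E (1/2) := expNegInvGlue.pos_of_pos (by norm_num)
  set κ := E (1/2) * E (1/2) * (H z₀ / 2) with hκ
  have hκ0 : 0 < κ := by positivity
  set τ := κ * volume.real K with hτ
  have hτ0 : 0 < τ := by positivity
  obtain ⟨η, n1, n2, n3, n4, n5, n6, n7⟩ := cutoff_many P hP K Metric.isClosed_closedBall
    (hPΩ.mono_right hKΩ) (τ / 16) (by positivity)
  set vΩ := volume.real Ω with hvΩ
  have hvΩ0 : 0 ≤ vΩ := measureReal_nonneg
  have hm0 : 0 < m := by positivity
  set M := 2 * m + 8 * vΩ / τ with hMdef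
  have hM0 : 0 < M := by positivity
  have hMm : 2 * m ≤ M := by
    have : 0 ≤ 8 * vΩ / τ := by positivity
    linarith
  have hMv : 2 / M * vΩ ≤ τ / 4 := by
    have : 8 * vΩ / τ ≤ M := by linarith
    rw [div_le_iff₀ hτ0] at this
    rw [div_mul_eq_mul_div, div_le_iff₀ hM0]
    linarith
  let g : ℝ × ℝ → ℝ := fun z => η z * E (u₁ z - u₂ z - ε) * E (1 - u₂ z / M) * E (1 + u₁ z / M)
  have hgc : ContDiffOn ℝ 1 g Ω := by
    refine ((n1.contDiffOn.mul (hEc.comp_contDiffOn ((hu₁.sub hu₂).sub contDiffOn_const))).mul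
      (hEc.comp_contDiffOn (contDiffOn_const.sub (hu₂.div_const M)))).mul
      (hEc.comp_contDiffOn (contDiffOn_const.add (hu₁.div_const M)))
  have hg0 : ∀ z ∈ frontier Ω, ∀ᶠ w in 𝓝[Ω] z, g w = 0 := by
    intro z hz
    rcases hbd z hz with h | h | h | h
    · filter_upwards [nhdsWithin_le_nhds (n4 z h)] with w hw
      simp [g, hw]
    · filter_upwards [h.eventually_ge_atTop M] with w hw
      have : E (1 - u₂ w / M) = 0 := expNegInvGlue.zero_of_nonpos (by
        have : 1 ≤ u₂ w / M := by rwa [le_div_iff₀ hM0, one_mul]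
        linarith)
      simp [g, this]
    · filter_upwards [h.eventually_le_atBot (-M)] with w hw
      have : E (1 + u₁ w / M) = 0 := expNegInvGlue.zero_of_nonpos (by
        have : u₁ w / M ≤ -1 := by rw [div_le_iff₀ hM0]; linarith
        linarith)
      simp [g, this]
    · filter_upwards [h.eventually (gt_mem_nhds hε0)] with w hw
      have : E (u₁ w - u₂ w - ε) = 0 := expNegInvGlue.zero_of_nonpos (by linarith)
      simp [g, this]
  let L : ℝ × ℝ → ℝ := fun z => K.indicator (fun _ => κ) z - Ω.indicator (fun _ => 2 / M) z - 4 * ‖fderiv ℝ η z‖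
  have hKi : Integrable (K.indicator (fun _ => κ)) :=
    (integrableOn_const (isCompact_closedBall _ _).measure_lt_top.ne).integrable_indicator measurableSet_closedBall
  have hΩi : Integrable (Ω.indicator (fun _ => 2 / M)) :=
    (integrableOn_const hb.measure_lt_top.ne).integrable_indicator hΩ.measurableSet
  have hLi : Integrable L := (hKi.sub hΩi).sub (n6.const_mul 4)
  have hLint : ∫ z, L z = τ - 2 / M * vΩ - 4 * ∫ z, ‖fderiv ℝ η z‖ := by
    have e1 : ∫ z, L z = _ := integral_sub (hKi.sub hΩi) (n6.const_mul 4)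
    have e2 := integral_sub hKi hΩi
    have e3 : ∫ z, (K.indicator (fun _ => κ) - Ω.indicator (fun _ => 2 / M)) z = τ - 2 / M * vΩ := by
      rw [show (fun z => (K.indicator (fun _ => κ) - Ω.indicator (fun _ => 2 / M)) z) = fun z => K.indicator (fun _ => κ) z - Ω.indicator (fun _ => 2 / M) z from rfl, e2,
        integral_indicator measurableSet_closedBall, integral_indicator hΩ.measurableSet,
        setIntegral_const, setIntegral_const, smul_eq_mul, smul_eq_mul]
      rw [hτ, hvΩ]; ring
    rw [e1, integral_const_mul]
    exact congrArg (fun t => t - 4 * ∫ z, ‖fderiv ℝ η z‖) e3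
  have hfin : ∫ z, L z ≤ 0 := by
    refine div_int hΩ hb (F := fun z => g z * X z) (G := fun z => g z * Y z) (hgc.mul hXc) ?_ (hgc.mul hYc) ?_ hLi ?_ ?_
    · intro z hz; filter_upwards [hg0 z hz] with w hw; simp [hw]
    · intro z hz; filter_upwards [hg0 z hz] with w hw; simp [hw]
    · intro z hz
      have D1 := (hdiff hu₁ z hz)
      have D2 := (hdiff hu₂ z hz)
      have GX := g_deriv η u₁ u₂ X z M ε (1, 0) (n1.differentiable one_ne_zero z) D1 D2 (hdiff hXc z hz)
      have GY := g_deriv η u₁ u₂ Y z M ε (0, 1) (n1.differentiable one_ne_zero z) D1 D2 (hdiff hYc z hz)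
      have halg := pointwise_alg (η z) (E (u₁ z - u₂ z - ε)) (E (1 - u₂ z / M)) (E (1 + u₁ z / M))
        (deriv E (u₁ z - u₂ z - ε)) (deriv E (1 - u₂ z / M)) (deriv E (1 + u₁ z / M)) M ‖fderiv ℝ η z‖
        (fderiv ℝ η z (1, 0)) (fderiv ℝ η z (0, 1)) (pd1 u₁ z) (pd2 u₁ z) (pd1 u₂ z) (pd2 u₂ z) (X z) (Y z)
        hM0 (n2 z) (n3 z) (expNegInvGlue.nonneg _) (E_le_one _) (expNegInvGlue.nonneg _) (E_le_one _)
        (expNegInvGlue.nonneg _) (E_le_one _)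
        (by rw [(E_hasDeriv _).deriv]; exact E_deriv_nonneg _) (by rw [(E_hasDeriv _).deriv]; exact E_deriv_le _)
        (by rw [(E_hasDeriv _).deriv]; exact E_deriv_nonneg _) (by rw [(E_hasDeriv _).deriv]; exact E_deriv_le _)
        (by simpa using (fderiv ℝ η z).le_opNorm (1, 0)) (by simpa using (fderiv ℝ η z).le_opNorm (0, 1))
        (by
          have t1 := abs_le.1 (comp_le (pd1 u₁ z) _ (hWp u₁ z) (by rw [Wg_sq]; nlinarith [sq_nonneg (pd2 u₁ z)]))
          have t2 := abs_le.1 (comp_le (pd1 u₂ z) _ (hWp u₂ z) (by rw [Wg_sq]; nlinarith [sq_nonneg (pd2 u₂ z)]))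
          show |pd1 u₁ z / Wg u₁ z - pd1 u₂ z / Wg u₂ z| ≤ 2
          rw [abs_le]; constructor <;> linarith)
        (by
          have t1 := abs_le.1 (comp_le (pd2 u₁ z) _ (hWp u₁ z) (by rw [Wg_sq]; nlinarith [sq_nonneg (pd1 u₁ z)]))
          have t2 := abs_le.1 (comp_le (pd2 u₂ z) _ (hWp u₂ z) (by rw [Wg_sq]; nlinarith [sq_nonneg (pd1 u₂ z)]))
          show |pd2 u₁ z / Wg u₁ z - pd2 u₂ z / Wg u₂ z| ≤ 2
          rw [abs_le]; constructor <;> linarith)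
        (one_side _ _ _ _ _ _ (Wg_ge u₁ z) (Wg_ge u₂ z) (Wg_sq _ _) (Wg_sq _ _))
        (by
          have := one_side _ _ _ _ _ _ (Wg_ge u₂ z) (Wg_ge u₁ z) (Wg_sq u₂ z) (Wg_sq u₁ z)
          show -1 ≤ pd1 u₁ z * (pd1 u₁ z / Wg u₁ z - pd1 u₂ z / Wg u₂ z) + pd2 u₁ z * (pd2 u₁ z / Wg u₁ z - pd2 u₂ z / Wg u₂ z)
          linarith)
      have hlow : K.indicator (fun _ => κ) z ≤ η z * E (1 - u₂ z / M) * E (1 + u₁ z / M) * H z := by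
        by_cases hzK : z ∈ K
        · rw [indicator_of_mem hzK, n5 z hzK, one_mul, hκ]
          obtain ⟨-, b1, b2, b3⟩ := hball hzK
          have b2' := abs_lt.1 b2
          have b3' := abs_lt.1 b3
          have k1 : E (1/2) ≤ E (1 - u₂ z / M) := by
            apply expNegInvGlue.monotone
            have : u₂ z / M ≤ 1/2 := by rw [div_le_iff₀ hM0]; linarith
            linarith
          have k2 : E (1/2) ≤ E (1 + u₁ z / M) := by
            apply expNegInvGlue.monotone
            have : -(1/2) ≤ u₁ z / M := by rw [le_div_iff₀ hM0]; linarith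
            linarith
          exact mul_le_mul (mul_le_mul k1 k2 hEh.le (expNegInvGlue.nonneg _)) b1.le (by positivity)
            (mul_nonneg (expNegInvGlue.nonneg _) (expNegInvGlue.nonneg _))
        · rw [indicator_of_notMem hzK]
          exact mul_nonneg (mul_nonneg (mul_nonneg (n2 z) (expNegInvGlue.nonneg _)) (expNegInvGlue.nonneg _)) (hH0 z)
      have hdv := hXY z hz
      have hfd : fderiv ℝ Y z (0, 1) = - fderiv ℝ X z (1, 0) := by linarith
      rw [hfd] at GY
      rw [← pd1_eq D1, ← pd1_eq D2] at GX
      rw [← pd2_eq D1, ← pd2_eq D2] at GY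
      show K.indicator (fun _ => κ) z - Ω.indicator (fun _ => 2 / M) z - 4 * ‖fderiv ℝ η z‖ ≤ _
      rw [indicator_of_mem hz]
      have hsum := congrArg₂ (· + ·) GX GY
      refine le_trans ?_ (le_of_eq hsum.symm)
      have hlow2 : K.indicator (fun _ => κ) z ≤ η z * E (1 - u₂ z / M) * E (1 + u₁ z / M) *
        (deriv E (u₁ z - u₂ z - ε) * ((pd1 u₁ z - pd1 u₂ z) * X z + (pd2 u₁ z - pd2 u₂ z) * Y z)) := hlow
      simp only [hE] at hlow2 halg ⊢
      linarith
    · intro z hz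
      have hzK : z ∉ K := fun h => hz (hKΩ h)
      simp only [L, indicator_of_notMem hz, indicator_of_notMem hzK]
      have := norm_nonneg (fderiv ℝ η z)
      linarith
  rw [hLint] at hfin
  linarith

lemma half {Ω : Set (ℝ × ℝ)} (hΩ : IsOpen Ω) (hb : Bornology.IsBounded Ω) (hc : IsPreconnected Ω)
    {u₁ u₂ : ℝ × ℝ → ℝ}
    (h₁ : IsMSE u₁ Ω) (h₂ : IsMSE u₂ Ω) (P : Set (ℝ × ℝ)) (hP : P.Finite) (hPΩ : Disjoint P Ω)
    (hbd : ∀ z ∈ frontier Ω, z ∈ P ∨ Tendsto u₂ (𝓝[Ω] z) atTop ∨ Tendsto u₁ (𝓝[Ω] z) atBot ∨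
      Tendsto (fun w => u₁ w - u₂ w) (𝓝[Ω] z) (𝓝 0))
    {y : ℝ × ℝ} (hy : y ∈ frontier Ω) (hyt : Tendsto (fun w => u₁ w - u₂ w) (𝓝[Ω] y) (𝓝 0)) :
    ∀ z ∈ Ω, u₁ z ≤ u₂ z := by
  have D1 : ∀ z ∈ Ω, DifferentiableAt ℝ u₁ z := fun z hz =>
    (h₁.1.differentiableOn two_ne_zero).differentiableAt (hΩ.mem_nhds hz)
  have D2 : ∀ z ∈ Ω, DifferentiableAt ℝ u₂ z := fun z hz =>
    (h₂.1.differentiableOn two_ne_zero).differentiableAt (hΩ.mem_nhds hz)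
  have hd : ∀ z ∈ Ω, HasFDerivAt (fun w => expNegInvGlue (u₁ w - u₂ w)) (0 : ℝ × ℝ →L[ℝ] ℝ) z := by
    intro z hz
    have F1 : HasFDerivAt (fun w => expNegInvGlue (u₁ w - u₂ w)) _ z :=
      (E_hasDeriv _).comp_hasFDerivAt z ((D1 z hz).hasFDerivAt.sub (D2 z hz).hasFDerivAt)
    have hzero : ((u₁ z - u₂ z)⁻¹ ^ 2 * expNegInvGlue (u₁ z - u₂ z)) • (fderiv ℝ u₁ z - fderiv ℝ u₂ z) = 0 := by
      by_cases hp : 0 < u₁ z - u₂ z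
      · obtain ⟨e1, e2⟩ := key hΩ hb h₁ h₂ P hP hPΩ hbd hz hp
        rw [pd1_eq (D1 z hz), pd1_eq (D2 z hz)] at e1
        rw [pd2_eq (D1 z hz), pd2_eq (D2 z hz)] at e2
        have : fderiv ℝ u₁ z = fderiv ℝ u₂ z := by
          ext <;> simp [e1, e2]
        rw [this]; simp
      · simp [expNegInvGlue.zero_of_nonpos (not_lt.1 hp)]
    rw [hzero] at F1
    exact F1
  have hconst : ∀ z ∈ Ω, ∀ w ∈ Ω, expNegInvGlue (u₁ z - u₂ z) = expNegInvGlue (u₁ w - u₂ w) := by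
    intro z hz w hw
    exact hΩ.is_const_of_fderiv_eq_zero hc (fun x hx => (hd x hx).differentiableAt.differentiableWithinAt)
      (fun x hx => (hd x hx).fderiv) hz hw
  intro z hz
  have hne : (𝓝[Ω] y).NeBot := mem_closure_iff_nhdsWithin_neBot.1 hy.1
  have t1 : Tendsto (fun w => expNegInvGlue (u₁ w - u₂ w)) (𝓝[Ω] y) (𝓝 (expNegInvGlue 0)) :=
    ((expNegInvGlue.contDiff (n := 1)).continuous.tendsto 0).comp hyt
  have t2 : Tendsto (fun w => expNegInvGlue (u₁ w - u₂ w)) (𝓝[Ω] y) (𝓝 (expNegInvGlue (u₁ z - u₂ z))) := by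
    refine tendsto_const_nhds.congr' ?_
    filter_upwards [self_mem_nhdsWithin] with w hw using hconst z hz w hw
  have := tendsto_nhds_unique t2 t1
  rw [expNegInvGlue.zero, expNegInvGlue.zero_iff_nonpos] at this
  linarith

/-- Uniqueness for the Jenkins–Serrin problem with at least one continuous boundary arc:
two solutions of the minimal surfaces equation with boundary value `+∞` on each segment
`A_j`, `−∞` on each segment `B_j`, and the same continuous boundary values on each convex
arc `C_j`, coincide on `Ω`. -/
theorem jenkins_serrin_uniqueness_with_arcs
    (Ω : Set (ℝ × ℝ)) (hΩo : IsOpen Ω) (hΩb : Bornology.IsBounded Ω)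
    (hΩne : Ω.Nonempty) (hΩsc : SimplyConnectedSpace ↥Ω)
    (k l n : ℕ) (hn : 1 ≤ n)
    (A : Fin k → (ℝ × ℝ) × (ℝ × ℝ)) (B : Fin l → (ℝ × ℝ) × (ℝ × ℝ))
    (C : Fin n → Set (ℝ × ℝ))
    (hAnd : ∀ j, (A j).1 ≠ (A j).2) (hBnd : ∀ j, (B j).1 ≠ (B j).2)
    (hC1 : ∀ j, IsC1Arc (C j))
    (hconv : ∀ j, LocallyConvexAlong Ω (C j))
    (V : Set (ℝ × ℝ)) (hVfin : V.Finite)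
    (hbd : frontier Ω = (⋃ j, segment ℝ (A j).1 (A j).2) ∪
      (⋃ j, segment ℝ (B j).1 (B j).2) ∪ (⋃ j, C j) ∪ V)
    (hAA : ∀ j j', j ≠ j' →
      Disjoint (openSegment ℝ (A j).1 (A j).2) (openSegment ℝ (A j').1 (A j').2))
    (hBB : ∀ j j', j ≠ j' →
      Disjoint (openSegment ℝ (B j).1 (B j).2) (openSegment ℝ (B j').1 (B j').2))
    (hAB : ∀ j j',
      Disjoint (openSegment ℝ (A j).1 (A j).2) (openSegment ℝ (B j').1 (B j').2))
    (hCC : ∀ j j', j ≠ j' → Disjoint (C j) (C j'))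
    (hCA : ∀ j j', Disjoint (C j) (openSegment ℝ (A j').1 (A j').2))
    (hCB : ∀ j j', Disjoint (C j) (openSegment ℝ (B j').1 (B j').2))
    (u₁ u₂ : ℝ × ℝ → ℝ) (hu₁ : IsMSE u₁ Ω) (hu₂ : IsMSE u₂ Ω)
    (hA₁ : ∀ j, ∀ z ∈ openSegment ℝ (A j).1 (A j).2, Tendsto u₁ (𝓝[Ω] z) atTop)
    (hA₂ : ∀ j, ∀ z ∈ openSegment ℝ (A j).1 (A j).2, Tendsto u₂ (𝓝[Ω] z) atTop)
    (hB₁ : ∀ j, ∀ z ∈ openSegment ℝ (B j).1 (B j).2, Tendsto u₁ (𝓝[Ω] z) atBot)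
    (hB₂ : ∀ j, ∀ z ∈ openSegment ℝ (B j).1 (B j).2, Tendsto u₂ (𝓝[Ω] z) atBot)
    (hC : ∀ j, ∀ z ∈ C j, ∃ L : ℝ,
      Tendsto u₁ (𝓝[Ω] z) (𝓝 L) ∧ Tendsto u₂ (𝓝[Ω] z) (𝓝 L)) :
    EqOn u₁ u₂ Ω := by
  obtain ⟨hP1, hP2⟩ : (V ∪ ((range fun j => (A j).1) ∪ (range fun j => (A j).2)) ∪
      ((range fun j => (B j).1) ∪ (range fun j => (B j).2))).Finite ∧
      Disjoint (V ∪ ((range fun j => (A j).1) ∪ (range fun j => (A j).2)) ∪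
      ((range fun j => (B j).1) ∪ (range fun j => (B j).2))) Ω := by
    refine ⟨(hVfin.union ((finite_range _).union (finite_range _))).union
      ((finite_range _).union (finite_range _)), ?_⟩
    have hdis : Disjoint (frontier Ω) Ω := by
      rw [hΩo.frontier_eq]; exact disjoint_sdiff_left
    refine hdis.mono_left ?_
    rw [hbd]
    rintro z ((hz | ⟨j, rfl⟩ | ⟨j, rfl⟩) | ⟨j, rfl⟩ | ⟨j, rfl⟩)
    · exact Or.inr hz
    · exact Or.inl (Or.inl (Or.inl (mem_iUnion.2 ⟨j, left_mem_segment ℝ _ _⟩)))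
    · exact Or.inl (Or.inl (Or.inl (mem_iUnion.2 ⟨j, right_mem_segment ℝ _ _⟩)))
    · exact Or.inl (Or.inl (Or.inr (mem_iUnion.2 ⟨j, left_mem_segment ℝ _ _⟩)))
    · exact Or.inl (Or.inl (Or.inr (mem_iUnion.2 ⟨j, right_mem_segment ℝ _ _⟩)))
  set P := V ∪ ((range fun j => (A j).1) ∪ (range fun j => (A j).2)) ∪
      ((range fun j => (B j).1) ∪ (range fun j => (B j).2)) with hPdef
  have hcls : ∀ z ∈ frontier Ω, z ∈ P ∨ (∃ j, z ∈ openSegment ℝ (A j).1 (A j).2) ∨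
      (∃ j, z ∈ openSegment ℝ (B j).1 (B j).2) ∨ ∃ j, z ∈ C j := by
    intro z hz
    rw [hbd] at hz
    rcases hz with ((hz | hz) | hz) | hz
    · obtain ⟨j, hj⟩ := mem_iUnion.1 hz
      rw [← insert_endpoints_openSegment] at hj
      rcases hj with hj | hj | hj
      · exact Or.inl (Or.inl (Or.inr (Or.inl ⟨j, hj.symm⟩)))
      · exact Or.inl (Or.inl (Or.inr (Or.inr ⟨j, hj.symm⟩)))
      · exact Or.inr (Or.inl ⟨j, hj⟩)
    · obtain ⟨j, hj⟩ := mem_iUnion.1 hz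
      rw [← insert_endpoints_openSegment] at hj
      rcases hj with hj | hj | hj
      · exact Or.inl (Or.inr (Or.inl ⟨j, hj.symm⟩))
      · exact Or.inl (Or.inr (Or.inr ⟨j, hj.symm⟩))
      · exact Or.inr (Or.inr (Or.inl ⟨j, hj⟩))
    · exact Or.inr (Or.inr (Or.inr (mem_iUnion.1 hz)))
    · exact Or.inl (Or.inl (Or.inl hz))
  have hC12 : ∀ j, ∀ z ∈ C j, Tendsto (fun w => u₁ w - u₂ w) (𝓝[Ω] z) (𝓝 0) ∧
      Tendsto (fun w => u₂ w - u₁ w) (𝓝[Ω] z) (𝓝 0) := by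
    intro j z hz
    obtain ⟨L, l1, l2⟩ := hC j z hz
    exact ⟨by simpa using l1.sub l2, by simpa using l2.sub l1⟩
  have hpre : IsPreconnected Ω := by
    rw [isPreconnected_iff_preconnectedSpace]
    infer_instance
  obtain ⟨y, hy⟩ : (C ⟨0, hn⟩).Nonempty := by
    obtain ⟨γ, -, -, -, h⟩ := hC1 ⟨0, hn⟩
    rw [h]
    exact ⟨γ (1/2), 1/2, by norm_num, rfl⟩
  have hyf : y ∈ frontier Ω := by
    rw [hbd]; exact Or.inl (Or.inr (mem_iUnion.2 ⟨_, hy⟩))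
  have l1 : ∀ z ∈ Ω, u₁ z ≤ u₂ z := by
    refine half hΩo hΩb hpre hu₁ hu₂ P hP1 hP2 (fun z hz => ?_) hyf (hC12 _ y hy).1
    rcases hcls z hz with h | ⟨j, h⟩ | ⟨j, h⟩ | ⟨j, h⟩
    · exact Or.inl h
    · exact Or.inr (Or.inl (hA₂ j z h))
    · exact Or.inr (Or.inr (Or.inl (hB₁ j z h)))
    · exact Or.inr (Or.inr (Or.inr (hC12 j z h).1))
  have l2 : ∀ z ∈ Ω, u₂ z ≤ u₁ z := by
    refine half hΩo hΩb hpre hu₂ hu₁ P hP1 hP2 (fun z hz => ?_) hyf (hC12 _ y hy).2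
    rcases hcls z hz with h | ⟨j, h⟩ | ⟨j, h⟩ | ⟨j, h⟩
    · exact Or.inl h
    · exact Or.inr (Or.inl (hA₁ j z h))
    · exact Or.inr (Or.inr (Or.inl (hB₂ j z h)))
    · exact Or.inr (Or.inr (Or.inr (hC12 j z h).2))
  exact fun z hz => le_antisymm (l1 z hz) (l2 z hz)
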